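/- arXiv:2005.09611 — 4 statements merged into one kernel-verified Lean document; each statement's English description precedes it below -/
import Mathlib

section
/- Let T1 be a quadtree, let n be a leaf of T1 with |n| < ℓ, and let T2 = T1 ∪ {n ++ [i] : i ∈ Fin (2^d)} be the quadtree obtained by expanding n. Suppose π̂1* is an abstract path in T1 whose cost Ĵ(π̂1*) is minimal among all abstract paths in T1. Then there exists an abstract path π̂2 in T2 with Ĵ(π̂1*) ≥ Ĵ(π̂2). -/
open Finset Filter

/-- The penalty constant `M = 2^{dℓ}(λ₁ + ε λ₂) + γ`. -/
noncomputable def Mval (d ℓ : ℕ) (ε lam1 lam2 γ : ℝ) : ℝ :=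
  2 ^ (d * ℓ) * (lam1 + ε * lam2) + γ

/-- The cost `c` on leaves. -/
noncomputable def cst (d ℓ : ℕ) (p : List (Fin (2 ^ d)) → ℝ) (ε lam1 lam2 γ : ℝ)
    (x : List (Fin (2 ^ d))) : ℝ :=
  if p x ≤ ε then lam1 + lam2 * p x else Mval d ℓ ε lam1 lam2 γ

/-- Auxiliary recursion for `V`, with fuel equal to `ℓ - length`. -/
noncomputable def Vaux (d : ℕ) (c : List (Fin (2 ^ d)) → ℝ) : ℕ → List (Fin (2 ^ d)) → ℝ
  | 0, n => c n
  | k + 1, n => ((2 : ℝ) ^ d)⁻¹ * ∑ i : Fin (2 ^ d), Vaux d c k (n ++ [i])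

/-- The function `V`: `V(n) = c(n)` on leaves (length `ℓ`), and
`V(n) = 2^{-d} ∑_{n' child of n} V(n')` on interior nodes. -/
noncomputable def Vnode (d ℓ : ℕ) (c : List (Fin (2 ^ d)) → ℝ) (n : List (Fin (2 ^ d))) : ℝ :=
  Vaux d c (ℓ - n.length) n

/-- A quadtree: a set of nodes (lists of length ≤ ℓ) containing the root, closed under
parents, and sibling-complete. -/
def IsQuadtree (d ℓ : ℕ) (T : Set (List (Fin (2 ^ d)))) : Prop :=
  [] ∈ T ∧ (∀ n ∈ T, n.length ≤ ℓ) ∧ (∀ n ∈ T, n ≠ [] → n.dropLast ∈ T) ∧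
    ∀ (n : List (Fin (2 ^ d))) (i j : Fin (2 ^ d)), n ++ [i] ∈ T → n ++ [j] ∈ T

/-- A leaf of a quadtree `T`: an element of `T` none of whose children lies in `T`. -/
def IsLeafOf (d : ℕ) (T : Set (List (Fin (2 ^ d)))) (n : List (Fin (2 ^ d))) : Prop :=
  n ∈ T ∧ ∀ i : Fin (2 ^ d), n ++ [i] ∉ T

/-- The `i`-th coordinate of the center of the hypercube represented by node `n`. -/
noncomputable def center (d ℓ : ℕ) (n : List (Fin (2 ^ d))) (i : Fin d) : ℝ :=
  (∑ j : Fin n.length,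
      ((((n.get j).val / 2 ^ (i : ℕ)) % 2 : ℕ) : ℝ) * (2 : ℝ) ^ ((ℓ : ℤ) - (j : ℕ) - 1)) +
    (2 : ℝ) ^ ((ℓ : ℤ) - (n.length : ℕ) - 1)

/-- Nodal neighbors: the sup-distance of the centers equals `2^{r(n)-1} + 2^{r(m)-1}`
and exactly one coordinate realizes this value. -/
def NodalNeighbors (d ℓ : ℕ) (n m : List (Fin (2 ^ d))) : Prop :=
  (∀ i : Fin d, |center d ℓ n i - center d ℓ m i| ≤
      (2 : ℝ) ^ ((ℓ : ℤ) - (n.length : ℕ) - 1) + (2 : ℝ) ^ ((ℓ : ℤ) - (m.length : ℕ) - 1)) ∧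
    ∃! i : Fin d, |center d ℓ n i - center d ℓ m i| =
      (2 : ℝ) ^ ((ℓ : ℤ) - (n.length : ℕ) - 1) + (2 : ℝ) ^ ((ℓ : ℤ) - (m.length : ℕ) - 1)

/-- An abstract path in the quadtree `T` from start leaf `s0` to goal leaf `sg`. -/
structure AbstractPath (d ℓ : ℕ) (T : Set (List (Fin (2 ^ d)))) (s0 sg : List (Fin (2 ^ d))) where
  R : ℕ
  z : Fin (R + 1) → List (Fin (2 ^ d))
  inj : Function.Injective z
  leaf : ∀ i, IsLeafOf d T (z i)
  start : z 0 <+: s0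
  goal : z (Fin.last R) <+: sg
  neigh : ∀ i : Fin R, NodalNeighbors d ℓ (z i.castSucc) (z i.succ)

/-- The cost `Ĵ` of an abstract path. -/
noncomputable def pathCost (d ℓ : ℕ) (c : List (Fin (2 ^ d)) → ℝ) {T : Set (List (Fin (2 ^ d)))}
    {s0 sg : List (Fin (2 ^ d))} (pth : AbstractPath d ℓ T s0 sg) : ℝ :=
  ∑ i, (2 : ℝ) ^ (d * (ℓ - (pth.z i).length)) * Vnode d ℓ c (pth.z i)

/-- An abstract path is ε-feasible if every leaf descendant of every node of the path
has occupancy probability at most ε. -/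
def EpsFeasible (d ℓ : ℕ) (p : List (Fin (2 ^ d)) → ℝ) (ε : ℝ) {T : Set (List (Fin (2 ^ d)))}
    {s0 sg : List (Fin (2 ^ d))} (pth : AbstractPath d ℓ T s0 sg) : Prop :=
  ∀ i, ∀ x : List (Fin (2 ^ d)), pth.z i <+: x → x.length = ℓ → p x ≤ ε

theorem halfWidth_append_singleton (d ℓ : ℕ) (n : List (Fin (2 ^ d))) (a : Fin (2 ^ d)) :
    (2 : ℝ) ^ ((ℓ : ℤ) - ((n ++ [a]).length : ℕ) - 1) =
      (2 : ℝ) ^ ((ℓ : ℤ) - (n.length : ℕ) - 1) / 2 := by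
  rw [div_eq_mul_inv, ← zpow_sub_one₀ (by norm_num : (2 : ℝ) ≠ 0)]
  congr 1
  simp
  ring

theorem center_append_singleton (d ℓ : ℕ) (n : List (Fin (2 ^ d))) (a : Fin (2 ^ d)) (k : Fin d) :
    center d ℓ (n ++ [a]) k = center d ℓ n k +
      (((a.val / 2 ^ (k : ℕ) % 2 : ℕ) : ℝ) - 1 / 2) * (2 : ℝ) ^ ((ℓ : ℤ) - n.length - 1) := by
  have hlen : (n ++ [a]).length = n.length + 1 := by simp
  have hsum : ∀ m : List (Fin (2 ^ d)), ∑ j : Fin m.length,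
      ((((m.get j).val / 2 ^ (k : ℕ)) % 2 : ℕ) : ℝ) * (2 : ℝ) ^ ((ℓ : ℤ) - (j : ℕ) - 1) =
      ∑ j ∈ Finset.range m.length,
        (((((m[j]?.map Fin.val).getD 0) / 2 ^ (k : ℕ)) % 2 : ℕ) : ℝ) *
          (2 : ℝ) ^ ((ℓ : ℤ) - (j : ℕ) - 1) := by
    intro m
    rw [Finset.sum_range]
    simp
  unfold center
  rw [hsum, hsum, halfWidth_append_singleton, hlen, Finset.sum_range_succ]
  have hcongr : ∀ j ∈ Finset.range n.length, (n ++ [a])[j]? = n[j]? := fun j hj =>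
    List.getElem?_append_left (Finset.mem_range.mp hj)
  rw [Finset.sum_congr rfl fun j hj => by rw [hcongr j hj]]
  simp
  ring

theorem NodalNeighbors.symm {d ℓ : ℕ} {n m : List (Fin (2 ^ d))} (h : NodalNeighbors d ℓ n m) :
    NodalNeighbors d ℓ m n := by
  simpa only [NodalNeighbors, abs_sub_comm, add_comm] using h

theorem not_nodalNeighbors_self {d ℓ : ℕ} (n : List (Fin (2 ^ d))) :
    ¬ NodalNeighbors d ℓ n n := by
  rintro ⟨-, i, hi, -⟩
  have : (0 : ℝ) < 2 ^ ((ℓ : ℤ) - (n.length : ℕ) - 1) := by positivity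
  simp only [sub_self, abs_zero] at hi
  linarith

/-- The child index with prescribed binary digits. -/
theorem exists_digits_eq {d : ℕ} (f : Fin d → Fin 2) :
    ∃ a : Fin (2 ^ d), ∀ k : Fin d, a.val / 2 ^ (k : ℕ) % 2 = f k :=
  ⟨finFunctionFinEquiv f, fun k =>
    congrArg Fin.val (congrFun (finFunctionFinEquiv.symm_apply_apply f) k)⟩

/-- A nodal neighbor of `n` is a nodal neighbor of some child of `n`. -/
theorem NodalNeighbors.exists_child {d ℓ : ℕ} {n z : List (Fin (2 ^ d))}
    (h : NodalNeighbors d ℓ z n) : ∃ a, NodalNeighbors d ℓ z (n ++ [a]) := by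
  classical
  obtain ⟨hle, i, hi, huniq⟩ := h
  obtain ⟨a, ha⟩ := exists_digits_eq (d := d)
    fun k => if 0 ≤ center d ℓ z k - center d ℓ n k then 1 else 0
  have hw : (0 : ℝ) < 2 ^ ((ℓ : ℤ) - (z.length : ℕ) - 1) := by positivity
  have hh : (0 : ℝ) < 2 ^ ((ℓ : ℤ) - (n.length : ℕ) - 1) := by positivity
  refine ⟨a, ?_⟩
  unfold NodalNeighbors
  simp only [halfWidth_append_singleton, center_append_singleton, ha]
  refine ⟨fun k => ?_, i, ?_, fun k hk => huniq k ?_⟩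
  · have := hle k
    rw [abs_le] at this ⊢
    split_ifs <;> norm_num <;> constructor <;> linarith
  · beta_reduce at hi ⊢
    split_ifs with hs
    · rw [abs_of_nonneg hs] at hi
      norm_num
      rw [abs_of_nonneg] <;> linarith
    · rw [abs_of_neg (not_le.mp hs)] at hi
      norm_num
      rw [abs_of_nonpos] <;> linarith
  · beta_reduce at hk ⊢
    refine le_antisymm (hle k) ?_
    split_ifs at hk with hs
    · rw [abs_of_nonneg hs]
      norm_num at hk
      rcases abs_cases (center d ℓ z k - (center d ℓ n k +
        1 / 2 * 2 ^ ((ℓ : ℤ) - (n.length : ℕ) - 1))) with ⟨h1, h2⟩ | ⟨h1, h2⟩ <;> linarith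
    · rw [abs_of_neg (not_le.mp hs)]
      norm_num at hk
      rcases abs_cases (center d ℓ z k - (center d ℓ n k +
        -(1 / 2 * 2 ^ ((ℓ : ℤ) - (n.length : ℕ) - 1)))) with ⟨h1, h2⟩ | ⟨h1, h2⟩ <;> linarith

/-- Siblings whose indices differ in exactly one binary digit are nodal neighbors. -/
theorem nodalNeighbors_siblings {d ℓ : ℕ} (n : List (Fin (2 ^ d))) {a b : Fin (2 ^ d)} {k : Fin d}
    (hk : a.val / 2 ^ (k : ℕ) % 2 ≠ b.val / 2 ^ (k : ℕ) % 2)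
    (hne : ∀ j : Fin d, j ≠ k → a.val / 2 ^ (j : ℕ) % 2 = b.val / 2 ^ (j : ℕ) % 2) :
    NodalNeighbors d ℓ (n ++ [a]) (n ++ [b]) := by
  have hh : (0 : ℝ) < 2 ^ ((ℓ : ℤ) - (n.length : ℕ) - 1) := by positivity
  unfold NodalNeighbors
  simp only [halfWidth_append_singleton, center_append_singleton, add_halves,
    add_sub_add_left_eq_sub, ← sub_mul, sub_sub_sub_cancel_right, abs_mul, abs_of_pos hh]
  have hone : |((a.val / 2 ^ (k : ℕ) % 2 : ℕ) : ℝ) - ((b.val / 2 ^ (k : ℕ) % 2 : ℕ) : ℝ)| = 1 := by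
    rcases Nat.mod_two_eq_zero_or_one (a.val / 2 ^ (k : ℕ)) with h1 | h1 <;>
    rcases Nat.mod_two_eq_zero_or_one (b.val / 2 ^ (k : ℕ)) with h2 | h2 <;>
    simp_all
  have hzero : ∀ j : Fin d, j ≠ k →
      |((a.val / 2 ^ (j : ℕ) % 2 : ℕ) : ℝ) - ((b.val / 2 ^ (j : ℕ) % 2 : ℕ) : ℝ)| = 0 := by
    intro j hj
    rw [hne j hj, sub_self, abs_zero]
  refine ⟨fun j => ?_, k, ?_, fun j hj => ?_⟩
  · by_cases hj : j = k
    · rw [hj, hone, one_mul]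
    · rw [hzero j hj, zero_mul]
      exact hh.le
  · beta_reduce
    rw [hone, one_mul]
  · by_contra hjk
    beta_reduce at hj
    rw [hzero j hjk, zero_mul] at hj
    exact hh.ne hj

/-- The nodal-neighbor graph on the children of `n`. -/
def siblingGraph (d ℓ : ℕ) (n : List (Fin (2 ^ d))) : SimpleGraph (Fin (2 ^ d)) where
  Adj a b := NodalNeighbors d ℓ (n ++ [a]) (n ++ [b])
  symm := ⟨fun _ _ h => h.symm⟩
  loopless := ⟨fun _ h => not_nodalNeighbors_self _ h⟩

theorem siblingGraph_preconnected (d ℓ : ℕ) (n : List (Fin (2 ^ d))) :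
    (siblingGraph d ℓ n).Preconnected := by
  classical
  have key : ∀ (f g : Fin d → Fin 2) (S : Finset (Fin d)), (siblingGraph d ℓ n).Reachable
      (finFunctionFinEquiv f) (finFunctionFinEquiv fun k => if k ∈ S then g k else f k) := by
    intro f g S
    have hdig : ∀ (f : Fin d → Fin 2) (k : Fin d),
        (finFunctionFinEquiv f).val / 2 ^ (k : ℕ) % 2 = f k := fun f k =>
      congrArg Fin.val (congrFun (finFunctionFinEquiv.symm_apply_apply f) k)
    induction S using Finset.induction_on with
    | empty => simp
    | insert k S hk ih =>
      refine ih.trans ?_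
      by_cases hfg : f k = g k
      · have : (fun j => if j ∈ insert k S then g j else f j) =
            fun j => if j ∈ S then g j else f j := by
          funext j
          by_cases hj : j = k <;> simp_all
        rw [this]
      · refine SimpleGraph.Adj.reachable (nodalNeighbors_siblings (k := k) n ?_ fun j hj => ?_)
        · rw [hdig, hdig]
          simpa [hk, Fin.val_inj] using hfg
        · rw [hdig, hdig]
          simp [hj]
  intro a b
  simpa using key (finFunctionFinEquiv.symm a) (finFunctionFinEquiv.symm b) Finset.univ

/-- Any two children of `n` are joined by a simple chain of children of `n`. -/
theorem exists_sibling_chain (d ℓ : ℕ) (n : List (Fin (2 ^ d))) (a b : Fin (2 ^ d)) :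
    ∃ C : List (Fin (2 ^ d)), C.Nodup ∧ C.head? = some a ∧ C.getLast? = some b ∧
      (C.map fun i => n ++ [i]).IsChain (NodalNeighbors d ℓ) := by
  classical
  obtain ⟨w⟩ := siblingGraph_preconnected d ℓ n a b
  refine ⟨w.toPath.1.support, w.toPath.2.support_nodup, ?_, ?_, ?_⟩
  · rw [List.head?_eq_some_head (SimpleGraph.Walk.support_ne_nil _), SimpleGraph.Walk.head_support]
  · rw [List.getLast?_eq_some_getLast (SimpleGraph.Walk.support_ne_nil _),
      SimpleGraph.Walk.getLast_support]
  · rw [List.isChain_map]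
    exact w.toPath.1.isChain_adj_support

theorem Vaux_nonneg {d ℓ : ℕ} {c : List (Fin (2 ^ d)) → ℝ}
    (hc : ∀ x : List (Fin (2 ^ d)), x.length = ℓ → 0 ≤ c x) (k : ℕ) (m : List (Fin (2 ^ d)))
    (h : k + m.length = ℓ) : 0 ≤ Vaux d c k m := by
  induction k generalizing m with
  | zero => exact hc m (by omega)
  | succ k ih =>
    refine mul_nonneg (by positivity) (Finset.sum_nonneg fun i _ => ih _ ?_)
    simp
    omega

theorem cst_nonneg {d ℓ : ℕ} {p : List (Fin (2 ^ d)) → ℝ} {ε lam1 lam2 γ : ℝ}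
    (hε0 : 0 ≤ ε) (h10 : 0 < lam1) (h20 : 0 ≤ lam2) (hγ : 0 < γ) {x : List (Fin (2 ^ d))}
    (hx : 0 ≤ p x) : 0 ≤ cst d ℓ p ε lam1 lam2 γ x := by
  unfold cst Mval
  split_ifs <;> positivity

/-- The contribution of a single node to the cost of an abstract path. -/
noncomputable def nodeCost (d ℓ : ℕ) (c : List (Fin (2 ^ d)) → ℝ) (m : List (Fin (2 ^ d))) : ℝ :=
  (2 : ℝ) ^ (d * (ℓ - m.length)) * Vnode d ℓ c m

theorem nodeCost_nonneg {d ℓ : ℕ} {c : List (Fin (2 ^ d)) → ℝ}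
    (hc : ∀ x : List (Fin (2 ^ d)), x.length = ℓ → 0 ≤ c x) {m : List (Fin (2 ^ d))}
    (hm : m.length ≤ ℓ) : 0 ≤ nodeCost d ℓ c m :=
  mul_nonneg (by positivity) (Vaux_nonneg hc _ _ (by omega))

theorem sum_nodeCost_children {d ℓ : ℕ} (c : List (Fin (2 ^ d)) → ℝ) {n : List (Fin (2 ^ d))}
    (hlen : n.length < ℓ) : ∑ i, nodeCost d ℓ c (n ++ [i]) = nodeCost d ℓ c n := by
  obtain ⟨k, hk⟩ : ∃ k, ℓ - n.length = k + 1 := ⟨ℓ - n.length - 1, by omega⟩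
  have hk' : ∀ i, ℓ - (n ++ [i]).length = k := fun i => by
    simp
    omega
  simp only [nodeCost, Vnode, hk, hk', Vaux, ← Finset.mul_sum]
  rw [mul_add, mul_one, pow_add]
  field_simp

/-- The list form of an abstract path: a nonempty simple chain of leaves from `s0` to `sg`. -/
def IsPathList (d ℓ : ℕ) (T : Set (List (Fin (2 ^ d)))) (s0 sg : List (Fin (2 ^ d)))
    (L : List (List (Fin (2 ^ d)))) : Prop :=
  L ≠ [] ∧ L.Nodup ∧ (∀ x ∈ L, IsLeafOf d T x) ∧ L.IsChain (NodalNeighbors d ℓ) ∧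
    (∀ x ∈ L.head?, x <+: s0) ∧ ∀ x ∈ L.getLast?, x <+: sg

theorem AbstractPath.isPathList {d ℓ : ℕ} {T : Set (List (Fin (2 ^ d)))}
    {s0 sg : List (Fin (2 ^ d))} (π : AbstractPath d ℓ T s0 sg) :
    IsPathList d ℓ T s0 sg (List.ofFn π.z) := by
  refine ⟨by simp, List.nodup_ofFn.mpr π.inj, ?_, ?_, ?_, ?_⟩
  · simpa only [List.forall_mem_ofFn_iff] using π.leaf
  · rw [List.isChain_iff_getElem]
    intro i hi
    simp only [List.length_ofFn] at hi
    simp only [List.getElem_ofFn]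
    exact π.neigh ⟨i, by omega⟩
  · simpa using π.start
  · intro x hx
    rw [List.getLast?_eq_getElem?] at hx
    simp only [List.length_ofFn, List.getElem?_ofFn] at hx
    have := π.goal
    simp_all [Fin.last]

theorem pathCost_eq_sum {d ℓ : ℕ} (c : List (Fin (2 ^ d)) → ℝ) {T : Set (List (Fin (2 ^ d)))}
    {s0 sg : List (Fin (2 ^ d))} (π : AbstractPath d ℓ T s0 sg) :
    pathCost d ℓ c π = ((List.ofFn π.z).map (nodeCost d ℓ c)).sum := by
  rw [List.map_ofFn, List.sum_ofFn]
  rfl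

theorem IsPathList.exists_abstractPath {d ℓ : ℕ} {T : Set (List (Fin (2 ^ d)))}
    {s0 sg : List (Fin (2 ^ d))} {L : List (List (Fin (2 ^ d)))} (h : IsPathList d ℓ T s0 sg L) :
    ∃ π : AbstractPath d ℓ T s0 sg, List.ofFn π.z = L := by
  obtain ⟨hne, hnd, hleaf, hch, hs, hg⟩ := h
  obtain ⟨R, hR⟩ : ∃ R, L.length = R + 1 :=
    Nat.exists_eq_succ_of_ne_zero (by simpa using hne)
  refine ⟨⟨R, fun i => L[i.val]'(by omega), ?_, ?_, ?_, ?_, ?_⟩, ?_⟩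
  · intro i j hij
    exact Fin.ext ((hnd.getElem_inj_iff).mp hij)
  · exact fun i => hleaf _ (List.getElem_mem _)
  · refine hs _ ?_
    simp [List.head?_eq_getElem?]
  · refine hg _ ?_
    simp [List.getLast?_eq_getElem?, hR]
  · intro i
    exact List.isChain_iff_getElem.mp hch i.val (by omega)
  · exact List.ext_getElem (by simp [hR]) fun i _ _ => by simp only [List.getElem_ofFn]

theorem exists_child_prefix {d : ℕ} {n s : List (Fin (2 ^ d))} (h : n <+: s)
    (hlen : n.length < s.length) : ∃ a, n ++ [a] <+: s := by
  obtain ⟨t, rfl⟩ := h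
  cases t with
  | nil => simp at hlen
  | cons a t => exact ⟨a, t, by simp⟩

theorem IsLeafOf.expand {d : ℕ} {T : Set (List (Fin (2 ^ d)))} {n x : List (Fin (2 ^ d))}
    (hx : IsLeafOf d T x) (hne : x ≠ n) : IsLeafOf d (T ∪ {m | ∃ i, m = n ++ [i]}) x := by
  refine ⟨Or.inl hx.1, ?_⟩
  rintro i (h | ⟨j, hj⟩)
  · exact hx.2 i h
  · exact hne (List.append_inj_left' hj rfl)

theorem IsLeafOf.expand_child {d : ℕ} {T : Set (List (Fin (2 ^ d)))} {n : List (Fin (2 ^ d))}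
    (hn : IsLeafOf d T n) (hT : ∀ x ∈ T, x ≠ [] → x.dropLast ∈ T) (i : Fin (2 ^ d)) :
    IsLeafOf d (T ∪ {m | ∃ i, m = n ++ [i]}) (n ++ [i]) := by
  refine ⟨Or.inr ⟨i, rfl⟩, ?_⟩
  rintro j (h | ⟨k, hk⟩)
  · refine hn.2 i ?_
    simpa using hT _ h (by simp)
  · simpa using congrArg List.length hk

/-- Replacing an expanded leaf by a simple chain of its children yields a path in the
expanded tree. -/
theorem IsPathList.exists_expand {d ℓ : ℕ} {T : Set (List (Fin (2 ^ d)))}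
    {s0 sg n : List (Fin (2 ^ d))} {A B : List (List (Fin (2 ^ d)))}
    (hs0 : n.length < s0.length) (hsg : n.length < sg.length)
    (hT : ∀ x ∈ T, x ≠ [] → x.dropLast ∈ T) (hn : IsLeafOf d T n)
    (h : IsPathList d ℓ T s0 sg (A ++ n :: B)) :
    ∃ C : List (Fin (2 ^ d)), C.Nodup ∧
      IsPathList d ℓ (T ∪ {m | ∃ i, m = n ++ [i]}) s0 sg
        (A ++ (C.map (fun i => n ++ [i]) ++ B)) := by
  classical
  obtain ⟨-, hnd, hleaf, hch, hs, hg⟩ := h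
  obtain ⟨hndA, hndnB, hdisj⟩ := List.nodup_append.mp hnd
  obtain ⟨hnB, hndB⟩ := List.nodup_cons.mp hndnB
  obtain ⟨hchA, hchnB, hAn⟩ := List.isChain_append.mp hch
  obtain ⟨hBn, hchB⟩ := List.isChain_cons.mp hchnB
  obtain ⟨a, haA, has⟩ : ∃ a, (∀ x ∈ A.getLast?, NodalNeighbors d ℓ x (n ++ [a])) ∧
      (A = [] → n ++ [a] <+: s0) := by
    rcases A.eq_nil_or_concat with rfl | ⟨A', x, rfl⟩
    · obtain ⟨a, ha⟩ := exists_child_prefix (hs n (by simp)) hs0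
      exact ⟨a, by simp, fun _ => ha⟩
    · obtain ⟨a, ha⟩ := (hAn x (by simp) n (by simp)).exists_child
      exact ⟨a, by simpa using ha, by simp⟩
  obtain ⟨b, hbB, hbs⟩ : ∃ b, (∀ y ∈ B.head?, NodalNeighbors d ℓ (n ++ [b]) y) ∧
      (B = [] → n ++ [b] <+: sg) := by
    rcases B with _ | ⟨y, B'⟩
    · obtain ⟨b, hb⟩ := exists_child_prefix (hg n (by simp)) hsg
      exact ⟨b, by simp, fun _ => hb⟩
    · obtain ⟨b, hb⟩ := (hBn y (by simp)).symm.exists_child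
      exact ⟨b, by simpa using hb.symm, by simp⟩
  obtain ⟨C, hndC, hCa, hCb, hchC⟩ := exists_sibling_chain d ℓ n a b
  have hCne : C ≠ [] := by
    rintro rfl
    simp at hCa
  have hA : ∀ x ∈ A, x ∈ T ∧ x ≠ n := fun x hx =>
    ⟨(hleaf x (by simp [hx])).1, hdisj x hx n (by simp)⟩
  have hB : ∀ x ∈ B, x ∈ T ∧ x ≠ n := fun x hx =>
    ⟨(hleaf x (by simp [hx])).1, fun h => hnB (h ▸ hx)⟩
  refine ⟨C, hndC, by simp [hCne], ?_, ?_, ?_, ?_, ?_⟩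
  · refine List.nodup_append.mpr ⟨hndA, List.nodup_append.mpr ⟨?_, hndB, ?_⟩, ?_⟩
    · exact hndC.map fun i j hij => by simpa using hij
    · rintro x hx y hy rfl
      obtain ⟨i, -, rfl⟩ := List.mem_map.mp hx
      exact hn.2 i (hB _ hy).1
    · rintro x hx y hy rfl
      rcases List.mem_append.mp hy with hy | hy
      · obtain ⟨i, -, rfl⟩ := List.mem_map.mp hy
        exact hn.2 i (hA _ hx).1
      · exact hdisj x hx x (by simp [hy]) rfl
  · intro x hx
    rcases List.mem_append.mp hx with hx | hx
    · exact (hleaf x (by simp [hx])).expand (hA x hx).2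
    · rcases List.mem_append.mp hx with hx | hx
      · obtain ⟨i, -, rfl⟩ := List.mem_map.mp hx
        exact hn.expand_child hT i
      · exact (hleaf x (by simp [hx])).expand (hB x hx).2
  · refine List.isChain_append.mpr ⟨hchA, List.isChain_append.mpr ⟨hchC, hchB, ?_⟩, ?_⟩
    · intro x hx y hy
      simp only [List.getLast?_map, hCb, Option.map_some, Option.mem_def, Option.some.injEq] at hx
      exact hx ▸ hbB y hy
    · intro x hx y hy
      simp only [List.head?_append, List.head?_map, hCa, Option.map_some, Option.some_or,
        Option.mem_def, Option.some.injEq] at hy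
      exact hy ▸ haA x hx
  · rcases A with _ | ⟨x, A'⟩
    · simpa [List.head?_append, List.head?_map, hCa] using has rfl
    · simpa using hs
  · rcases B.eq_nil_or_concat with rfl | ⟨B', y, rfl⟩
    · simpa [List.getLast?_append, List.getLast?_map, hCb] using hbs rfl
    · simpa [List.getLast?_append, List.getLast?_cons] using hg

/-- Theorem 1 (monotonic cost improvement under a single nodal expansion). -/
theorem statement0
    (d ℓ : ℕ) (hd : 1 ≤ d) (hℓ : 1 ≤ ℓ)
    (p : List (Fin (2 ^ d)) → ℝ)
    (hp : ∀ x : List (Fin (2 ^ d)), x.length = ℓ → 0 ≤ p x ∧ p x ≤ 1)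
    (ε lam1 lam2 γ : ℝ)
    (hε0 : 0 ≤ ε) (hε1 : ε ≤ 1) (h10 : 0 < lam1) (h11 : lam1 ≤ 1)
    (h20 : 0 ≤ lam2) (h21 : lam2 ≤ 1) (hγ : 0 < γ)
    (s0 sg : List (Fin (2 ^ d))) (hs0 : s0.length = ℓ) (hsg : sg.length = ℓ)
    (T1 T2 : Set (List (Fin (2 ^ d)))) (hT1 : IsQuadtree d ℓ T1)
    (n : List (Fin (2 ^ d))) (hleaf : IsLeafOf d T1 n) (hlen : n.length < ℓ)
    (hT2 : T2 = T1 ∪ {m | ∃ i : Fin (2 ^ d), m = n ++ [i]})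
    (pth1 : AbstractPath d ℓ T1 s0 sg)
    (hmin : ∀ q : AbstractPath d ℓ T1 s0 sg,
      pathCost d ℓ (cst d ℓ p ε lam1 lam2 γ) pth1 ≤ pathCost d ℓ (cst d ℓ p ε lam1 lam2 γ) q) :
    ∃ pth2 : AbstractPath d ℓ T2 s0 sg,
      pathCost d ℓ (cst d ℓ p ε lam1 lam2 γ) pth2 ≤
        pathCost d ℓ (cst d ℓ p ε lam1 lam2 γ) pth1 := by
  classical
  subst hT2
  have hc : ∀ x : List (Fin (2 ^ d)), x.length = ℓ → 0 ≤ cst d ℓ p ε lam1 lam2 γ x :=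
    fun x hx => cst_nonneg hε0 h10 h20 hγ (hp x hx).1
  have hL := pth1.isPathList
  rw [pathCost_eq_sum _ pth1]
  generalize List.ofFn pth1.z = L at hL
  by_cases hnL : n ∈ L
  · obtain ⟨A, B, rfl⟩ := List.append_of_mem hnL
    obtain ⟨C, hndC, hC⟩ := hL.exists_expand (by omega) (by omega) hT1.2.2.1 hleaf
    obtain ⟨π, hπ⟩ := hC.exists_abstractPath
    refine ⟨π, ?_⟩
    rw [pathCost_eq_sum, hπ]
    have hCle : ((C.map fun i => n ++ [i]).map (nodeCost d ℓ (cst d ℓ p ε lam1 lam2 γ))).sum ≤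
        nodeCost d ℓ (cst d ℓ p ε lam1 lam2 γ) n := by
      rw [List.map_map, ← List.sum_toFinset _ hndC, ← sum_nodeCost_children _ hlen]
      refine Finset.sum_le_sum_of_subset_of_nonneg (Finset.subset_univ _) fun i _ _ =>
        nodeCost_nonneg hc ?_
      simpa using hlen
    simp only [List.map_append, List.map_cons, List.sum_append, List.sum_cons]
    linarith
  · obtain ⟨hne, hnd, hlf, hrest⟩ := hL
    obtain ⟨π, hπ⟩ := IsPathList.exists_abstractPath (T := T1 ∪ {m | ∃ i, m = n ++ [i]})
      ⟨hne, hnd, fun x hx => (hlf x hx).expand fun h => hnL (h ▸ hx), hrest⟩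
    refine ⟨π, ?_⟩
    rw [pathCost_eq_sum, hπ]
end

section
/- Let π̂ be a finite set of nodes such that no element of π̂ is a proper prefix of another element of π̂ (as is the case for the set of nodes of an abstract path, which are distinct leaves of a common quadtree), and set Ĵ(π̂) = ∑_{z ∈ π̂} 2^{d·r(z)}·V(z). Then Ĵ(π̂) < M if and only if every leaf descendant x of every z ∈ π̂ satisfies p(x) ≤ ε. -/
open Finset

/-- The descendants of `n` at depth `k` below `n`. -/
def descendants (d : ℕ) : ℕ → List (Fin (2 ^ d)) → Finset (List (Fin (2 ^ d)))
  | 0, n => {n}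
  | k + 1, n => univ.biUnion fun i => descendants d k (n ++ [i])

theorem mem_descendants {d k : ℕ} {n x : List (Fin (2 ^ d))} :
    x ∈ descendants d k n ↔ n <+: x ∧ x.length = n.length + k := by
  induction k generalizing n with
  | zero =>
    simp only [descendants, mem_singleton, Nat.add_zero]
    constructor
    · rintro rfl
      exact ⟨List.prefix_rfl, rfl⟩
    · rintro ⟨h, hl⟩
      exact (h.eq_of_length hl.symm).symm
  | succ k ih =>
    simp only [descendants, mem_biUnion, mem_univ, true_and, ih, List.length_append,
      List.length_singleton]
    constructor
    · rintro ⟨i, h, hl⟩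
      exact ⟨(List.prefix_append n [i]).trans h, by omega⟩
    · rintro ⟨⟨t, rfl⟩, hl⟩
      cases t with
      | nil => simp at hl
      | cons i t => exact ⟨i, ⟨t, by simp⟩, by omega⟩

theorem pairwiseDisjoint_descendants_children (d k : ℕ) (n : List (Fin (2 ^ d))) :
    ((univ : Finset (Fin (2 ^ d))) : Set (Fin (2 ^ d))).PairwiseDisjoint
      fun i => descendants d k (n ++ [i]) := by
  intro i _ j _ hij
  refine Finset.disjoint_left.2 fun x hx hy => hij ?_
  have h := List.prefix_of_prefix_length_le (mem_descendants.1 hx).1 (mem_descendants.1 hy).1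
    (by simp)
  simpa using h.eq_of_length (by simp)

theorem card_descendants (d k : ℕ) (n : List (Fin (2 ^ d))) :
    (descendants d k n).card = 2 ^ (d * k) := by
  induction k generalizing n with
  | zero => simp [descendants]
  | succ k ih =>
    rw [descendants, card_biUnion (pairwiseDisjoint_descendants_children d k n)]
    simp [ih, Nat.mul_succ, pow_add, mul_comm]

theorem two_pow_mul_Vaux (d : ℕ) (c : List (Fin (2 ^ d)) → ℝ) (k : ℕ)
    (n : List (Fin (2 ^ d))) :
    (2 : ℝ) ^ (d * k) * Vaux d c k n = ∑ x ∈ descendants d k n, c x := by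
  induction k generalizing n with
  | zero => simp [descendants, Vaux]
  | succ k ih =>
    rw [descendants, sum_biUnion (pairwiseDisjoint_descendants_children d k n), Vaux]
    simp only [← ih, ← mul_sum]
    rw [Nat.mul_succ, pow_add]
    field_simp

theorem pairwiseDisjoint_descendants_of_antichain {d ℓ : ℕ} {S : Finset (List (Fin (2 ^ d)))}
    (hanti : ∀ z ∈ S, ∀ w ∈ S, z <+: w → z = w) :
    (S : Set (List (Fin (2 ^ d)))).PairwiseDisjoint
      fun z => descendants d (ℓ - z.length) z := by
  intro z hz w hw hzw
  refine Finset.disjoint_left.2 fun x hx hy => hzw ?_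
  have hzx := (mem_descendants.1 hx).1
  have hwx := (mem_descendants.1 hy).1
  rcases List.prefix_or_prefix_of_prefix hzx hwx with h | h
  · exact hanti z hz w hw h
  · exact (hanti w hw z hz h).symm

/-- Proposition 2: for a finite antichain `S` of nodes (no element a proper prefix of
another), the cost `Ĵ(S) = ∑_{z ∈ S} 2^{d r(z)} V(z)` satisfies `Ĵ(S) < M` iff every
leaf descendant `x` of every `z ∈ S` satisfies `p(x) ≤ ε`. -/
theorem statement5
    (d ℓ : ℕ) (hd : 1 ≤ d) (hℓ : 1 ≤ ℓ)
    (p : List (Fin (2 ^ d)) → ℝ)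
    (hp : ∀ x : List (Fin (2 ^ d)), x.length = ℓ → 0 ≤ p x ∧ p x ≤ 1)
    (ε lam1 lam2 γ : ℝ)
    (hε0 : 0 ≤ ε) (hε1 : ε ≤ 1) (h10 : 0 < lam1) (h11 : lam1 ≤ 1)
    (h20 : 0 ≤ lam2) (h21 : lam2 ≤ 1) (hγ : 0 < γ)
    (S : Finset (List (Fin (2 ^ d))))
    (hnode : ∀ z ∈ S, z.length ≤ ℓ)
    (hanti : ∀ z ∈ S, ∀ w ∈ S, z <+: w → z = w) :
    (∑ z ∈ S, (2 : ℝ) ^ (d * (ℓ - z.length)) * Vnode d ℓ (cst d ℓ p ε lam1 lam2 γ) z) <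
        Mval d ℓ ε lam1 lam2 γ ↔
      ∀ z ∈ S, ∀ x : List (Fin (2 ^ d)), z <+: x → x.length = ℓ → p x ≤ ε := by
  set U := S.biUnion fun z => descendants d (ℓ - z.length) z with hU
  have hmem : ∀ x, x ∈ U ↔ ∃ z ∈ S, z <+: x ∧ x.length = ℓ := by
    intro x
    simp only [hU, mem_biUnion, mem_descendants]
    refine exists_congr fun z => and_congr_right fun hz => ?_
    rw [Nat.add_sub_cancel' (hnode z hz)]
  have hsum : (∑ z ∈ S, (2 : ℝ) ^ (d * (ℓ - z.length)) *
      Vnode d ℓ (cst d ℓ p ε lam1 lam2 γ) z) = ∑ x ∈ U, cst d ℓ p ε lam1 lam2 γ x := by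
    rw [hU, sum_biUnion (pairwiseDisjoint_descendants_of_antichain hanti)]
    exact sum_congr rfl fun z _ => two_pow_mul_Vaux d _ _ z
  have hcard : (U.card : ℝ) ≤ 2 ^ (d * ℓ) := by
    have hsub : U ⊆ descendants d ℓ [] := by
      intro x hx
      obtain ⟨z, -, -, hl⟩ := (hmem x).1 hx
      exact mem_descendants.2 ⟨List.nil_prefix, by simpa using hl⟩
    have h := card_le_card hsub
    rw [card_descendants] at h
    exact_mod_cast h
  have hMpos : 0 < Mval d ℓ ε lam1 lam2 γ := by
    unfold Mval
    positivity
  rw [hsum]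
  constructor
  · intro hlt z hz x hzx hl
    by_contra hpx
    have hxU : x ∈ U := (hmem x).2 ⟨z, hz, hzx, hl⟩
    have hnonneg : ∀ y ∈ U, 0 ≤ cst d ℓ p ε lam1 lam2 γ y := by
      intro y hy
      obtain ⟨w, -, -, hly⟩ := (hmem y).1 hy
      have hpy := (hp y hly).1
      unfold cst
      split_ifs
      · positivity
      · exact hMpos.le
    have hle := single_le_sum hnonneg hxU
    rw [cst, if_neg hpx] at hle
    exact absurd hlt hle.not_gt
  · intro hgood
    have hbound : ∀ x ∈ U, cst d ℓ p ε lam1 lam2 γ x ≤ lam1 + ε * lam2 := by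
      intro x hx
      obtain ⟨z, hz, hzx, hl⟩ := (hmem x).1 hx
      have hpx := hgood z hz x hzx hl
      rw [cst, if_pos hpx, mul_comm ε]
      gcongr
    calc ∑ x ∈ U, cst d ℓ p ε lam1 lam2 γ x ≤ U.card * (lam1 + ε * lam2) := by
          simpa only [nsmul_eq_mul] using sum_le_card_nsmul U _ _ hbound
      _ ≤ 2 ^ (d * ℓ) * (lam1 + ε * lam2) := by gcongr
      _ < Mval d ℓ ε lam1 lam2 γ := lt_add_of_pos_right _ hγ
end

section
/- For every interior node n and every β > 0, Q(n; β) ≤ ∑_{s ∈ Int(n)} a(s). -/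
open Finset Filter

/-- Auxiliary recursion for `P`: fuel equals `ℓ - length`; `P = 0` on leaves and
`P(n) = L(n) + ∑_{n' child of n} P(n')` on interior nodes. -/
noncomputable def Paux (d : ℕ) (L : List (Fin (2 ^ d)) → ℝ) : ℕ → List (Fin (2 ^ d)) → ℝ
  | 0, _ => 0
  | k + 1, n => L n + ∑ i : Fin (2 ^ d), Paux d L k (n ++ [i])

/-- `P(n; β)` with `ΔL̃(n; β) = a(n) - b(n)/β`. -/
noncomputable def Pfun (d ℓ : ℕ) (a b : List (Fin (2 ^ d)) → ℝ) (β : ℝ)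
    (n : List (Fin (2 ^ d))) : ℝ :=
  Paux d (fun m => a m - b m / β) (ℓ - n.length) n

/-- Auxiliary recursion for `Q`: fuel equals `ℓ - length`; `Q = 0` on leaves and
`Q(n) = max{L(n) + ∑_{n' child of n} Q(n'), 0}` on interior nodes. -/
noncomputable def Qaux (d : ℕ) (L : List (Fin (2 ^ d)) → ℝ) : ℕ → List (Fin (2 ^ d)) → ℝ
  | 0, _ => 0
  | k + 1, n => max (L n + ∑ i : Fin (2 ^ d), Qaux d L k (n ++ [i])) 0

/-- `Q(n; β)` with `ΔL̃(n; β) = a(n) - b(n)/β`. -/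
noncomputable def Qfun (d ℓ : ℕ) (a b : List (Fin (2 ^ d)) → ℝ) (β : ℝ)
    (n : List (Fin (2 ^ d))) : ℝ :=
  Qaux d (fun m => a m - b m / β) (ℓ - n.length) n

/-- `Int(n)`: the finite set of interior nodes (length `< ℓ`) having `n` as a prefix,
including `n` itself: all `n ++ t` with `|n| + |t| < ℓ`. -/
def IntSet (d ℓ : ℕ) (n : List (Fin (2 ^ d))) : Finset (List (Fin (2 ^ d))) :=
  (Finset.range (ℓ - n.length)).biUnion fun k =>
    Finset.image (fun f : Fin k → Fin (2 ^ d) => n ++ List.ofFn f) Finset.univ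

theorem mem_IntSet {d ℓ : ℕ} {n s : List (Fin (2 ^ d))} :
    s ∈ IntSet d ℓ n ↔ ∃ t, n ++ t = s ∧ t.length < ℓ - n.length := by
  simp only [IntSet, Finset.mem_biUnion, Finset.mem_range, Finset.mem_image, Finset.mem_univ,
    true_and]
  constructor
  · rintro ⟨k, hk, f, rfl⟩
    exact ⟨List.ofFn f, rfl, by simpa using hk⟩
  · rintro ⟨t, rfl, ht⟩
    exact ⟨t.length, ht, t.get, by rw [List.ofFn_get]⟩

theorem IntSet_eq_insert {d ℓ : ℕ} {n : List (Fin (2 ^ d))} (hn : n.length < ℓ) :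
    IntSet d ℓ n = insert n (Finset.univ.biUnion fun i => IntSet d ℓ (n ++ [i])) := by
  ext s
  simp only [mem_IntSet, Finset.mem_insert, Finset.mem_biUnion, Finset.mem_univ, true_and]
  constructor
  · rintro ⟨_ | ⟨i, t⟩, rfl, ht⟩
    · simp
    · refine Or.inr ⟨i, t, by simp, ?_⟩
      simp only [List.length_cons, List.length_append, List.length_nil] at ht ⊢
      omega
  · rintro (rfl | ⟨i, t, rfl, ht⟩)
    · exact ⟨[], by simp, by simpa using hn⟩
    · refine ⟨i :: t, by simp, ?_⟩
      simp only [List.length_cons, List.length_append, List.length_nil] at ht ⊢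
      omega

theorem sum_IntSet {d ℓ : ℕ} {n : List (Fin (2 ^ d))} (hn : n.length < ℓ)
    (a : List (Fin (2 ^ d)) → ℝ) :
    ∑ s ∈ IntSet d ℓ n, a s = a n + ∑ i, ∑ s ∈ IntSet d ℓ (n ++ [i]), a s := by
  rw [IntSet_eq_insert hn, Finset.sum_insert, Finset.sum_biUnion]
  · intro i _ j _ hij
    refine Finset.disjoint_left.2 fun s hi hj => hij ?_
    obtain ⟨t, rfl, -⟩ := mem_IntSet.1 hi
    obtain ⟨u, hu, -⟩ := mem_IntSet.1 hj
    simp only [List.append_assoc, List.append_cancel_left_eq, List.singleton_append,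
      List.cons.injEq] at hu
    exact hu.1.symm
  · simp [mem_IntSet]

theorem sum_IntSet_nonneg {d ℓ : ℕ} {a : List (Fin (2 ^ d)) → ℝ}
    (ha : ∀ n : List (Fin (2 ^ d)), n.length < ℓ → 0 ≤ a n) (n : List (Fin (2 ^ d))) :
    0 ≤ ∑ s ∈ IntSet d ℓ n, a s := by
  refine Finset.sum_nonneg fun s hs => ?_
  obtain ⟨t, rfl, ht⟩ := mem_IntSet.1 hs
  exact ha _ (by rw [List.length_append]; omega)

theorem Qaux_le_sum_IntSet {d ℓ : ℕ} {a L : List (Fin (2 ^ d)) → ℝ}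
    (ha : ∀ n : List (Fin (2 ^ d)), n.length < ℓ → 0 ≤ a n)
    (hL : ∀ n : List (Fin (2 ^ d)), n.length < ℓ → L n ≤ a n)
    (k : ℕ) (n : List (Fin (2 ^ d))) (hk : ℓ - n.length = k) :
    Qaux d L k n ≤ ∑ s ∈ IntSet d ℓ n, a s := by
  induction k generalizing n with
  | zero => exact sum_IntSet_nonneg ha n
  | succ k ih =>
    have hn : n.length < ℓ := by omega
    refine max_le ?_ (sum_IntSet_nonneg ha n)
    rw [sum_IntSet hn]
    refine add_le_add (hL n hn) (Finset.sum_le_sum fun i _ => ih _ ?_)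
    rw [List.length_append, List.length_singleton]
    omega

/-- Lemma 3 (conclusion): `Q(n; β) ≤ ∑_{s ∈ Int(n)} a(s)`. -/
theorem statement11
    (d ℓ : ℕ) (hd : 1 ≤ d) (hℓ : 1 ≤ ℓ)
    (a b : List (Fin (2 ^ d)) → ℝ)
    (ha : ∀ n : List (Fin (2 ^ d)), n.length < ℓ → 0 ≤ a n)
    (hb : ∀ n : List (Fin (2 ^ d)), n.length < ℓ → 0 ≤ b n)
    (n : List (Fin (2 ^ d))) (hn : n.length < ℓ)
    (β : ℝ) (hβ : 0 < β) :
    Qfun d ℓ a b β n ≤ ∑ s ∈ IntSet d ℓ n, a s :=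
  Qaux_le_sum_IntSet ha (fun m hm => sub_le_self _ (div_nonneg (hb m hm) hβ.le)) _ n rfl
end

section
/- The limit of Q(n; β) as β → ∞, which equals ∑_{s ∈ Int(n)} a(s), is strictly positive for every interior node n if and only if a(n) > 0 for every node n of length ℓ − 1. (This is the mathematical content of Proposition 1: the Q-tree search algorithm returns the full-resolution tree as β → ∞, i.e., every interior node is eventually expanded, if and only if ΔI_Y(n) > 0 for all nodes n at depth ℓ − 1.) -/
open Finset Filter

theorem Paux_eq_sum_range (d : ℕ) (L : List (Fin (2 ^ d)) → ℝ) (k : ℕ) :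
    ∀ n : List (Fin (2 ^ d)),
      Paux d L k n = ∑ j ∈ range k, ∑ f : Fin j → Fin (2 ^ d), L (n ++ List.ofFn f) := by
  induction k with
  | zero => intro n; simp [Paux]
  | succ k ih =>
    intro n
    rw [Paux, sum_range_succ', add_comm]
    congr 1
    · simp_rw [ih]
      rw [sum_comm]
      refine sum_congr rfl fun j _ => ?_
      rw [← (Fin.consEquiv fun _ : Fin (j + 1) => Fin (2 ^ d)).sum_comp, Fintype.sum_prod_type]
      simp [Fin.consEquiv, List.ofFn_succ]
    · simp

theorem sum_IntSet_eq_Paux (d ℓ : ℕ) (a : List (Fin (2 ^ d)) → ℝ) (n : List (Fin (2 ^ d))) :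
    ∑ s ∈ IntSet d ℓ n, a s = Paux d a (ℓ - n.length) n := by
  rw [Paux_eq_sum_range, IntSet, sum_biUnion]
  · refine sum_congr rfl fun k _ => sum_image fun f _ g _ h => ?_
    exact List.ofFn_injective (List.append_cancel_left h)
  · intro i _ j _ hij
    refine disjoint_left.2 fun s hs ht => hij ?_
    simp only [mem_image, mem_univ, true_and] at hs ht
    obtain ⟨f, rfl⟩ := hs
    obtain ⟨g, hg⟩ := ht
    simpa using congrArg List.length (List.append_cancel_left hg).symm

theorem Paux_nonneg (d : ℕ) (L : List (Fin (2 ^ d)) → ℝ) (k : ℕ) :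
    ∀ n : List (Fin (2 ^ d)), (∀ m : List (Fin (2 ^ d)), m.length < n.length + k → 0 ≤ L m) →
      0 ≤ Paux d L k n := by
  induction k with
  | zero => intro n _; simp [Paux]
  | succ k ih =>
    intro n h
    rw [Paux]
    refine add_nonneg (h n (by omega)) (sum_nonneg fun i _ => ih _ fun m hm => h m ?_)
    simp at hm
    omega

theorem Qaux_eq_Paux (d : ℕ) (L : List (Fin (2 ^ d)) → ℝ) (k : ℕ) :
    ∀ n : List (Fin (2 ^ d)), (∀ m : List (Fin (2 ^ d)), m.length < n.length + k → 0 ≤ L m) →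
      Qaux d L k n = Paux d L k n := by
  induction k with
  | zero => intro n _; rfl
  | succ k ih =>
    intro n h
    have hsum : ∑ i, Qaux d L k (n ++ [i]) = ∑ i, Paux d L k (n ++ [i]) := by
      refine sum_congr rfl fun i _ => ih _ fun m hm => h m ?_
      simp at hm
      omega
    rw [Qaux, hsum]
    exact max_eq_left (Paux_nonneg d L (k + 1) n h)

theorem Paux_succ_pos (d : ℕ) (L : List (Fin (2 ^ d)) → ℝ) (k : ℕ) :
    ∀ n : List (Fin (2 ^ d)), (∀ m : List (Fin (2 ^ d)), m.length ≤ n.length + k → 0 ≤ L m) →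
      (∀ m : List (Fin (2 ^ d)), m.length = n.length + k → 0 < L m) →
      0 < Paux d L (k + 1) n := by
  induction k with
  | zero => intro n _ h; simpa [Paux] using h n rfl
  | succ k ih =>
    intro n h h'
    rw [Paux]
    refine add_pos_of_nonneg_of_pos (h n (by omega)) (sum_pos (fun i _ => ih _ ?_ ?_) univ_nonempty)
    · intro m hm
      simp at hm
      exact h m (by omega)
    · intro m hm
      simp at hm
      exact h' m (by omega)

theorem tendsto_Qaux {ι : Type*} {F : Filter ι} (d : ℕ) {L : ι → List (Fin (2 ^ d)) → ℝ}
    {a : List (Fin (2 ^ d)) → ℝ} (h : ∀ m, Tendsto (fun x => L x m) F (nhds (a m))) (k : ℕ) :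
    ∀ n : List (Fin (2 ^ d)), Tendsto (fun x => Qaux d (L x) k n) F (nhds (Qaux d a k n)) := by
  induction k with
  | zero => intro n; exact tendsto_const_nhds
  | succ k ih =>
    intro n
    exact ((h n).add (tendsto_finsetSum _ fun i _ => ih (n ++ [i]))).max tendsto_const_nhds

/-- Proposition 1: the limit of `Q(n; β)` as `β → ∞` — which equals
`∑_{s ∈ Int(n)} a(s)` — is strictly positive for every interior node `n` iff
`a(n) > 0` for every node `n` of length `ℓ - 1`. -/
theorem statement14
    (d ℓ : ℕ) (hd : 1 ≤ d) (hℓ : 1 ≤ ℓ)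
    (a b : List (Fin (2 ^ d)) → ℝ)
    (ha : ∀ n : List (Fin (2 ^ d)), n.length < ℓ → 0 ≤ a n)
    (hb : ∀ n : List (Fin (2 ^ d)), n.length < ℓ → 0 ≤ b n) :
    (∀ n : List (Fin (2 ^ d)), n.length < ℓ →
        Tendsto (fun β : ℝ => Qfun d ℓ a b β n) atTop (nhds (∑ s ∈ IntSet d ℓ n, a s)) ∧
          0 < ∑ s ∈ IntSet d ℓ n, a s) ↔
      ∀ n : List (Fin (2 ^ d)), n.length = ℓ - 1 → 0 < a n := by
  constructor
  · intro h n hn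
    have hpos := (h n (by omega)).2
    rw [sum_IntSet_eq_Paux, show ℓ - n.length = 1 by omega] at hpos
    simpa [Paux] using hpos
  · intro h n hn
    rw [sum_IntSet_eq_Paux]
    constructor
    · rw [← Qaux_eq_Paux d a _ n fun m hm => ha m (by omega)]
      refine tendsto_Qaux d (fun m => ?_) _ n
      simpa using (tendsto_const_nhds (x := a m)).sub
        ((tendsto_const_nhds (x := b m)).div_atTop tendsto_id)
    · obtain ⟨k, hk⟩ : ∃ k, ℓ - n.length = k + 1 := ⟨ℓ - n.length - 1, by omega⟩
      rw [hk]
      exact Paux_succ_pos d a k n (fun m hm => ha m (by omega)) fun m hm => h m (by omega)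
end
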